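/- arXiv:2011.11660 — 2 statements merged into one kernel-verified Lean document; each statement's English description precedes it below -/
import Mathlib

section
/- Exact Rényi divergence between one-dimensional Gaussians with equal variance: for every real α > 1, every σ > 0, and all real means μ₀, μ₁, the Rényi divergence of order α between the Gaussian measure on ℝ with mean μ₀ and variance σ² and the Gaussian measure on ℝ with mean μ₁ and variance σ² equals α · (μ₀ − μ₁)² / (2σ²). -/
open MeasureTheory ProbabilityTheory

/-- Rényi divergence of order `a` between measures `P` and `Q`:
`D_a(P ‖ Q) = (1/(a-1)) * log ∫ (dP/dQ)^a dQ`. -/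
noncomputable def renyiDiv {Ω : Type*} [MeasurableSpace Ω] (a : ℝ) (P Q : Measure Ω) : ℝ :=
  (a - 1)⁻¹ * Real.log (∫⁻ x, P.rnDeriv Q x ^ a ∂Q).toReal

theorem gaussianReal_eq_withDensity_aux (μ₀ μ₁ : ℝ) (v : NNReal) (hv : v ≠ 0) :
    gaussianReal μ₀ v = (gaussianReal μ₁ v).withDensity
      (fun x => ENNReal.ofReal
        (Real.exp ((2 * x * (μ₀ - μ₁) + μ₁ ^ 2 - μ₀ ^ 2) / (2 * v)))) := by
  have hv' : (v : ℝ) ≠ 0 := by exact_mod_cast hv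
  rw [gaussianReal_of_var_ne_zero _ hv, gaussianReal_of_var_ne_zero _ hv,
    ← withDensity_mul _ (measurable_gaussianPDF _ _) (by fun_prop)]
  congr 1
  ext x
  simp only [Pi.mul_apply, gaussianPDF]
  rw [← ENNReal.ofReal_mul (gaussianPDFReal_nonneg _ _ _)]
  congr 1
  simp only [gaussianPDFReal]
  rw [mul_assoc _ (Real.exp _) (Real.exp _), ← Real.exp_add]
  congr 2
  field_simp
  ring

/-- Exact Rényi divergence between one-dimensional Gaussians with equal variance:
`D_α(N(μ₀, σ²) ‖ N(μ₁, σ²)) = α (μ₀ - μ₁)² / (2σ²)`. -/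
theorem renyiDiv_gaussianReal (α σ μ₀ μ₁ : ℝ) (hα : 1 < α) (hσ : 0 < σ) :
    renyiDiv α (gaussianReal μ₀ (σ ^ 2).toNNReal) (gaussianReal μ₁ (σ ^ 2).toNNReal)
      = α * (μ₀ - μ₁) ^ 2 / (2 * σ ^ 2) := by
  have hs : (0 : ℝ) < σ ^ 2 := by positivity
  have hvs : (((σ ^ 2).toNNReal : NNReal) : ℝ) = σ ^ 2 := Real.coe_toNNReal _ hs.le
  rw [← hvs] at hs ⊢
  rw [Real.toNNReal_coe]
  generalize (σ ^ 2).toNNReal = v at hs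
  have hv : v ≠ 0 := by rintro rfl; simp at hs
  have hv' : (v : ℝ) ≠ 0 := hs.ne'
  have ha : α - 1 ≠ 0 := by linarith
  unfold renyiDiv
  have h1 := Measure.rnDeriv_withDensity (gaussianReal μ₁ v)
    (f := fun x => ENNReal.ofReal
        (Real.exp ((2 * x * (μ₀ - μ₁) + μ₁ ^ 2 - μ₀ ^ 2) / (2 * v)))) (by fun_prop)
  rw [← gaussianReal_eq_withDensity_aux μ₀ μ₁ v hv] at h1
  have h2 : ∫⁻ x, (gaussianReal μ₀ v).rnDeriv (gaussianReal μ₁ v) x ^ α ∂(gaussianReal μ₁ v)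
      = ∫⁻ x, ENNReal.ofReal (Real.exp (α * (μ₁ ^ 2 - μ₀ ^ 2) / (2 * v)) *
          Real.exp (α * (μ₀ - μ₁) / v * x)) ∂(gaussianReal μ₁ v) := by
    apply lintegral_congr_ae
    filter_upwards [h1] with x hx
    rw [hx, ENNReal.ofReal_rpow_of_pos (Real.exp_pos _), ← Real.exp_mul, ← Real.exp_add]
    congr 2
    field_simp
    ring
  have h3 : ∫ x, Real.exp (α * (μ₀ - μ₁) / v * x) ∂(gaussianReal μ₁ v)
      = Real.exp (μ₁ * (α * (μ₀ - μ₁) / v) + v * (α * (μ₀ - μ₁) / v) ^ 2 / 2) :=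
    congrFun (mgf_id_gaussianReal (μ := μ₁) (v := v)) (α * (μ₀ - μ₁) / v)
  rw [h2, ← ofReal_integral_eq_lintegral_ofReal
      ((integrable_exp_mul_gaussianReal _).const_mul _)
      (Filter.Eventually.of_forall fun x => by positivity),
    integral_const_mul, h3, ← Real.exp_add, ENNReal.toReal_ofReal (Real.exp_pos _).le,
    Real.log_exp]
  field_simp
  ring
end

section
/- Rényi differential privacy of the multivariate Gaussian mechanism with diagonal covariance: let α > 1 be real, let C > 0 and σ > 0 be reals, let n be a natural number, and let μ₀, μ₁ ∈ ℝⁿ satisfy ‖μ₀ − μ₁‖₂ ≤ C. Let P be the product over coordinates i of the Gaussian measure on ℝ with mean (μ₀)ᵢ and variance σ²C², and let Q be the analogous product with means (μ₁)ᵢ. Then D_α(P ‖ Q) = α · ‖μ₀ − μ₁‖₂² / (2σ²C²) ≤ α / (2σ²). That is, the Gaussian mechanism that adds coordinatewise independent N(0, σ²C²) noise to a vector-valued statistic of ℓ₂-sensitivity at most C is (α, α/(2σ²))-Rényi differentially private. -/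
open MeasureTheory ProbabilityTheory

open scoped ENNReal NNReal

lemma aux_lintegral_pi {n : ℕ} (μ : Fin n → Measure ℝ) [∀ i, IsProbabilityMeasure (μ i)]
    (f : Fin n → ℝ → ℝ≥0∞) (hf : ∀ i, Measurable (f i)) :
    ∫⁻ x, ∏ i, f i (x i) ∂(Measure.pi μ) = ∏ i, ∫⁻ x, f i x ∂(μ i) := by
  have h := lintegral_prod_eq_prod_lintegral_of_indepFun (μ := Measure.pi μ) Finset.univ
    (fun i (x : Fin n → ℝ) => f i (x i)) (iIndepFun_pi fun i => (hf i).aemeasurable)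
    (fun i => (hf i).comp (measurable_pi_apply i))
  rw [h]
  refine Finset.prod_congr rfl fun i _ => ?_
  exact (measurePreserving_eval μ i).lintegral_comp (hf i)

lemma aux_pi_withDensity {n : ℕ} (μ ν : Fin n → Measure ℝ) [∀ i, IsProbabilityMeasure (μ i)]
    [∀ i, IsProbabilityMeasure (ν i)]
    (f : Fin n → ℝ → ℝ≥0∞) (hf : ∀ i, Measurable (f i))
    (h : ∀ i, ν i = (μ i).withDensity (f i)) :
    Measure.pi ν = (Measure.pi μ).withDensity (fun x => ∏ i, f i (x i)) := by
  refine Measure.pi_eq fun s hs => ?_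
  have hS : MeasurableSet (Set.pi Set.univ s) := MeasurableSet.univ_pi hs
  rw [withDensity_apply _ hS, ← lintegral_indicator hS]
  have : (Set.pi Set.univ s).indicator (fun x : Fin n → ℝ => ∏ i, f i (x i))
      = fun x => ∏ i, (s i).indicator (f i) (x i) := by
    ext x
    by_cases hx : x ∈ Set.pi Set.univ s
    · rw [Set.indicator_of_mem hx]
      exact Finset.prod_congr rfl fun i _ => (Set.indicator_of_mem (hx i trivial) _).symm
    · rw [Set.indicator_of_notMem hx]
      have hx' : ∃ i, x i ∉ s i := by simpa using hx
      obtain ⟨i, hi⟩ := hx'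
      exact (Finset.prod_eq_zero (Finset.mem_univ i) (Set.indicator_of_notMem hi _)).symm
  rw [this, aux_lintegral_pi μ _ fun i => (hf i).indicator (hs i)]
  refine Finset.prod_congr rfl fun i _ => ?_
  rw [h i, withDensity_apply _ (hs i), lintegral_indicator (hs i)]

noncomputable def auxF (a b : ℝ) (v : ℝ≥0) (x : ℝ) : ℝ≥0∞ :=
  ENNReal.ofReal (Real.exp ((a - b) / v * x - (a ^ 2 - b ^ 2) / (2 * v)))

lemma measurable_auxF (a b : ℝ) (v : ℝ≥0) : Measurable (auxF a b v) := by
  unfold auxF; fun_prop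

lemma aux_gaussian (a b : ℝ) {v : ℝ≥0} (hv : v ≠ 0) :
    gaussianReal a v = (gaussianReal b v).withDensity (auxF a b v) := by
  rw [gaussianReal_of_var_ne_zero _ hv, gaussianReal_of_var_ne_zero _ hv,
    ← withDensity_mul _ (measurable_gaussianPDF _ _) (measurable_auxF _ _ _)]
  congr 1
  ext x
  have hv' : (v : ℝ) ≠ 0 := by exact_mod_cast hv
  simp only [Pi.mul_apply, gaussianPDF, auxF]
  rw [← ENNReal.ofReal_mul (gaussianPDFReal_nonneg _ _ _)]
  simp only [gaussianPDFReal]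
  rw [mul_assoc (_⁻¹), ← Real.exp_add]
  congr 3
  field_simp
  ring

lemma aux_moment (α a b : ℝ) (hα : 0 ≤ α) {v : ℝ≥0} (hv : v ≠ 0) :
    ∫⁻ x, auxF a b v x ^ α ∂(gaussianReal b v)
      = ENNReal.ofReal (Real.exp (α * (α - 1) * (a - b) ^ 2 / (2 * v))) := by
  have hv' : (v : ℝ) ≠ 0 := by exact_mod_cast hv
  have e : ∀ x, auxF a b v x ^ α = ENNReal.ofReal
      (Real.exp (-(α * (a ^ 2 - b ^ 2) / (2 * v))) * Real.exp (α * (a - b) / v * x)) := by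
    intro x
    rw [auxF, ENNReal.ofReal_rpow_of_nonneg (Real.exp_pos _).le hα, ← Real.exp_mul,
      ← Real.exp_add]
    congr 2
    ring
  simp_rw [e]
  rw [← ofReal_integral_eq_lintegral_ofReal
    ((integrable_exp_mul_gaussianReal _).const_mul _) (ae_of_all _ fun x => by positivity),
    integral_const_mul]
  have m := congrFun (mgf_id_gaussianReal (μ := b) (v := v)) (α * (a - b) / v)
  simp only [mgf, id] at m
  rw [m, ← Real.exp_add]
  congr 2
  field_simp
  ring


/-- Rényi differential privacy of the multivariate Gaussian mechanism with diagonal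
covariance: if `‖μ₀ - μ₁‖₂ ≤ C`, then the product Gaussians with per-coordinate variance
`σ²C²` satisfy `D_α(P ‖ Q) = α ‖μ₀ - μ₁‖₂² / (2σ²C²) ≤ α / (2σ²)`. -/
theorem renyiDiv_gaussian_mechanism (α C σ : ℝ) (hα : 1 < α) (hC : 0 < C) (hσ : 0 < σ)
    (n : ℕ) (μ₀ μ₁ : EuclideanSpace ℝ (Fin n)) (hsens : ‖μ₀ - μ₁‖ ≤ C) :
    renyiDiv α
        (Measure.pi fun i => gaussianReal (μ₀ i) (σ ^ 2 * C ^ 2).toNNReal)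
        (Measure.pi fun i => gaussianReal (μ₁ i) (σ ^ 2 * C ^ 2).toNNReal)
      = α * ‖μ₀ - μ₁‖ ^ 2 / (2 * σ ^ 2 * C ^ 2) ∧
    renyiDiv α
        (Measure.pi fun i => gaussianReal (μ₀ i) (σ ^ 2 * C ^ 2).toNNReal)
        (Measure.pi fun i => gaussianReal (μ₁ i) (σ ^ 2 * C ^ 2).toNNReal)
      ≤ α / (2 * σ ^ 2) := by
  have key : renyiDiv α
        (Measure.pi fun i => gaussianReal (μ₀ i) (σ ^ 2 * C ^ 2).toNNReal)
        (Measure.pi fun i => gaussianReal (μ₁ i) (σ ^ 2 * C ^ 2).toNNReal)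
      = α * ‖μ₀ - μ₁‖ ^ 2 / (2 * σ ^ 2 * C ^ 2) := by
    have hpos : 0 < σ ^ 2 * C ^ 2 := by positivity
    have hv : (σ ^ 2 * C ^ 2).toNNReal ≠ 0 := (Real.toNNReal_pos.2 hpos).ne'
    have hvc : (((σ ^ 2 * C ^ 2).toNNReal : ℝ≥0) : ℝ) = σ ^ 2 * C ^ 2 :=
      Real.coe_toNNReal _ hpos.le
    generalize (σ ^ 2 * C ^ 2).toNNReal = v at hv hvc
    have hα0 : 0 ≤ α := by linarith
    have hα1 : α - 1 ≠ 0 := by linarith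
    have hm : ∀ i, Measurable (auxF (μ₀ i) (μ₁ i) v) := fun i => measurable_auxF _ _ _
    unfold renyiDiv
    rw [aux_pi_withDensity (fun i => gaussianReal (μ₁ i) v) (fun i => gaussianReal (μ₀ i) v)
      (fun i => auxF (μ₀ i) (μ₁ i) v) hm (fun i => aux_gaussian _ _ hv)]
    have hM : Measurable (fun x : Fin n → ℝ => ∏ i, auxF (μ₀ i) (μ₁ i) v (x i)) :=
      Finset.measurable_prod _ fun i _ => (hm i).comp (measurable_pi_apply i)
    have hae := Measure.rnDeriv_withDensity (Measure.pi fun i => gaussianReal (μ₁ i) v) hM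
    rw [lintegral_congr_ae (hae.mono fun x hx => by
      show _ = ∏ i, auxF (μ₀ i) (μ₁ i) v (x i) ^ α
      rw [ENNReal.prod_rpow_of_nonneg hα0]; exact congrArg (· ^ α) hx)]
    rw [aux_lintegral_pi (fun i => gaussianReal (μ₁ i) v)
      (fun i x => auxF (μ₀ i) (μ₁ i) v x ^ α) (fun i => (hm i).pow_const α)]
    simp_rw [aux_moment α _ _ hα0 hv]
    rw [← ENNReal.ofReal_prod_of_nonneg (fun i _ => (Real.exp_pos _).le), ← Real.exp_sum,
      ENNReal.toReal_ofReal (Real.exp_pos _).le, Real.log_exp, ← Finset.sum_div,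
      ← Finset.mul_sum, EuclideanSpace.real_norm_sq_eq, hvc]
    simp only [PiLp.sub_apply]
    field_simp
  refine ⟨key, key.trans_le ?_⟩
  have h2 : ‖μ₀ - μ₁‖ ^ 2 ≤ C ^ 2 := by gcongr
  have hα0 : 0 ≤ α := by linarith
  calc α * ‖μ₀ - μ₁‖ ^ 2 / (2 * σ ^ 2 * C ^ 2) ≤ α * C ^ 2 / (2 * σ ^ 2 * C ^ 2) := by gcongr
    _ = α / (2 * σ ^ 2) := by field_simp
end
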